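/- arXiv:2511.07906 — 2 statements merged into one kernel-verified Lean document; each statement's English description precedes it below -/
import Mathlib

section
/- Let (G,E) be a self-similar action. The following are equivalent: (Fin) every g ∈ G admits at most finitely many minimal strongly g-fixed paths; (1) the inverse semigroup S(G,E) is closed; (2) the inverse semigroup S₀(G,E) is closed; (3) the inverse semigroup S₀₀(G,E) is closed. -/
noncomputable section

attribute [local instance] Classical.propDecidable

/-- Raw algebraic data of an inverse semigroup with zero, together with a domain
predicate singling out its genuine elements (the carrier may contain junk). -/
structure RawSem (T : Type) where
  mul : T → T → T
  star : T → T
  zero : T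
  dom : T → Prop

namespace RawSem

variable {T : Type} (R : RawSem T)

/-- The natural partial order: `t ≤ u` iff `t = u ⬝ t* ⬝ t`. -/
def le (t u : T) : Prop := t = R.mul u (R.mul (R.star t) t)

/-- Nonzero idempotents (belonging to the domain). -/
def NzIdem (e : T) : Prop := R.dom e ∧ R.mul e e = e ∧ e ≠ R.zero

/-- `F` covers the idempotent `e`: every nonzero idempotent below `e` meets some `f ∈ F`. -/
def Covers (F : Set T) (e : T) : Prop :=
  ∀ z, R.NzIdem z → R.le z e → ∃ f ∈ F, R.mul z f ≠ R.zero

/-- The set `F_t` of nonzero idempotents trivially fixed by `t`, i.e. `≤ t`. -/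
def TrivFix (t : T) : Set T := {e | R.NzIdem e ∧ R.le e t}

/-- The idempotent `e` is fixed by `t`:
`(t ⬝ f ⬝ t*) ⬝ f ≠ 0` for every nonzero idempotent `f ≤ e`. -/
def FixedBy (e t : T) : Prop :=
  ∀ f, R.NzIdem f → R.le f e → R.mul (R.mul (R.mul t f) (R.star t)) f ≠ R.zero

/-- The inverse semigroup is closed. -/
def Closed : Prop :=
  ∀ t, R.dom t → ∃ F : Finset T, ↑F ⊆ R.TrivFix t ∧ ∀ e ∈ R.TrivFix t, R.Covers ↑F e

/-- The inverse semigroup is topologically free. -/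
def TopFree : Prop :=
  ∀ t e, R.dom t → R.NzIdem e → R.FixedBy e t → ∃ f ∈ R.TrivFix t, R.mul f e ≠ R.zero

/-- The inverse semigroup is effective. -/
def Effective : Prop :=
  ∀ t e, R.dom t → R.NzIdem e → R.FixedBy e t →
    ∃ F : Finset T, ↑F ⊆ R.TrivFix t ∧ R.Covers (↑F) e

/-- The inverse semigroup is minimal. -/
def Minimal : Prop :=
  ∀ e f, R.NzIdem e → R.NzIdem f → ∃ Ts : Finset T, (∀ t ∈ Ts, R.dom t) ∧
    R.Covers ((fun t => R.mul (R.mul t f) (R.star t)) '' ↑Ts) e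

/-- The inverse semigroup is quasi-fundamental. -/
def QuasiFund : Prop :=
  ∀ s t, R.dom s → R.dom t → s ≠ R.zero → t ≠ R.zero →
    (∀ e, R.NzIdem e → R.mul (R.mul s e) (R.star s) = R.mul (R.mul t e) (R.star t)) →
    ∃ u, R.dom u ∧ u ≠ R.zero ∧ R.le u s ∧ R.le u t

/-- The inverse semigroup is fundamental. -/
def Fund : Prop :=
  ∀ s t, R.dom s → R.dom t →
    (∀ e, R.NzIdem e → R.mul (R.mul s e) (R.star s) = R.mul (R.mul t e) (R.star t)) → s = t

/-- The inverse semigroup is `E*`-unitary. -/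
def EUnitary : Prop := ∀ t e, R.dom t → R.NzIdem e → R.le e t → R.mul t t = t

/-- The inverse semigroup is locally contracting. -/
def LocContr : Prop :=
  ∀ e, R.NzIdem e → ∃ s, R.dom s ∧ ∃ F : Finset T, ∃ f₀ ∈ F,
    (∀ f ∈ F, R.NzIdem f ∧ R.le f (R.mul e (R.mul (R.star s) s))) ∧
    ∀ f ∈ F, R.Covers (↑F) (R.mul (R.mul s f) (R.star s)) ∧
      R.mul f₀ (R.mul (R.mul s f) (R.star s)) = R.zero

/-- The inverse semigroup is strongly locally contracting. -/
def StrLocContr : Prop :=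
  ∀ e, R.NzIdem e → ∃ s f₀ f₁, R.dom s ∧ R.NzIdem f₀ ∧ R.NzIdem f₁ ∧
    R.le f₀ f₁ ∧ R.le f₁ (R.mul e (R.mul (R.star s) s)) ∧
    R.le (R.mul (R.mul s f₁) (R.star s)) f₁ ∧
    R.mul f₀ (R.mul (R.mul s f₁) (R.star s)) = R.zero

end RawSem

/-- A self-similar action `(G, E)` of a discrete groupoid `G` on a directed graph `E`
sharing the vertex/unit set `V`, encoded by total operations together with axioms
that hold on composable inputs.  Arrows `g` have source `gs g` and range `gr g`;
edges `e` have source `es e` and range `er e`; `g · e` (written `act g e`) and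
`g |_e` (written `res g e`) are meaningful when `gs g = er e`. -/
structure SSA where
  V : Type
  G : Type
  E : Type
  gs : G → V
  gr : G → V
  es : E → V
  er : E → V
  one : V → G
  mul : G → G → G
  inv : G → G
  act : G → E → E
  res : G → E → G
  gs_one : ∀ v, gs (one v) = v
  gr_one : ∀ v, gr (one v) = v
  gs_mul : ∀ g h, gs g = gr h → gs (mul g h) = gs h
  gr_mul : ∀ g h, gs g = gr h → gr (mul g h) = gr g
  mul_assoc' : ∀ g h k, gs g = gr h → gs h = gr k → mul (mul g h) k = mul g (mul h k)
  one_mul' : ∀ g, mul (one (gr g)) g = g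
  mul_one' : ∀ g, mul g (one (gs g)) = g
  gs_inv : ∀ g, gs (inv g) = gr g
  gr_inv : ∀ g, gr (inv g) = gs g
  mul_inv' : ∀ g, mul g (inv g) = one (gr g)
  inv_mul' : ∀ g, mul (inv g) g = one (gs g)
  er_act : ∀ g e, gs g = er e → er (act g e) = gr g
  act_one : ∀ e, act (one (er e)) e = e
  act_mul : ∀ g h e, gs g = gr h → gs h = er e → act (mul g h) e = act g (act h e)
  gs_res : ∀ g e, gs g = er e → gs (res g e) = es e
  gr_res : ∀ g e, gs g = er e → gr (res g e) = es (act g e)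
  res_mul : ∀ g h e, gs g = gr h → gs h = er e →
    res (mul g h) e = mul (res g (act h e)) (res h e)

namespace SSA

/-- Finite paths in the graph: `Pth S a b` is the type of paths with range `a`
and source `b`; `cons e p` is the path `e · p`. -/
inductive Pth (S : SSA) : S.V → S.V → Type
  | nil (v : S.V) : Pth S v v
  | cons (e : S.E) {b : S.V} (p : Pth S (S.es e) b) : Pth S (S.er e) b

/-- The path category `E^*`, bundled: a finite path with its range and source. -/
structure Path (S : SSA) where
  rng : S.V
  src : S.V
  pth : S.Pth rng src

/-- Infinite paths: sequences of edges `e₁e₂⋯` with `es eᵢ = er e_{i+1}`. -/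
structure InfPath (S : SSA) where
  seq : ℕ → S.E
  chain : ∀ n, S.es (seq n) = S.er (seq (n + 1))

/-- A twist `σ = (σ_G, σ_⋈)` of the self-similar action, with values in the
unit circle `𝕋 ⊆ ℂ`. -/
structure Twist (S : SSA) where
  σG : S.G → S.G → ℂ
  σB : S.G → S.E → ℂ
  σG_unimod : ∀ g h, S.gs g = S.gr h → ‖σG g h‖ = 1
  σB_unimod : ∀ g e, S.gs g = S.er e → ‖σB g e‖ = 1
  σG_cocycle : ∀ g h k, S.gs g = S.gr h → S.gs h = S.gr k →
    σG g h * σG (S.mul g h) k = σG h k * σG g (S.mul h k)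
  σG_one_left : ∀ g, σG (S.one (S.gr g)) g = 1
  σG_one_right : ∀ g, σG g (S.one (S.gs g)) = 1
  σB_one : ∀ e, σB (S.one (S.er e)) e = 1
  σB_cocycle : ∀ g h e, S.gs g = S.gr h → S.gs h = S.er e →
    σB h e * (starRingEnd ℂ) (σB (S.mul g h) e) * σB g (S.act h e) =
      (starRingEnd ℂ) (σG (S.res g (S.act h e)) (S.res h e)) * σG g h

variable {S : SSA}

namespace Pth

def length : ∀ {a b : S.V}, S.Pth a b → ℕ
  | _, _, .nil _ => 0
  | _, _, .cons _ p => length p + 1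

def toList : ∀ {a b : S.V}, S.Pth a b → List S.E
  | _, _, .nil _ => []
  | _, _, .cons e p => e :: toList p

def comp : ∀ {a b c : S.V}, S.Pth a b → S.Pth b c → S.Pth a c
  | _, _, _, .nil _, q => q
  | _, _, _, .cons e p, q => .cons e (comp p q)

end Pth

def Path.length (p : Path S) : ℕ := p.pth.length

def Path.toList (p : Path S) : List S.E := p.pth.toList

/-- A vertex regarded as a path of length `0`. -/
def Path.vert (S : SSA) (v : S.V) : Path S := ⟨v, v, .nil v⟩

/-- An edge regarded as a path of length `1`. -/
def Path.ofEdge (S : SSA) (e : S.E) : Path S := ⟨S.er e, S.es e, .cons e (.nil (S.es e))⟩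

/-- Concatenation of paths (junk -- the first path -- when not composable). -/
def Path.comp (p q : Path S) : Path S :=
  if h : p.src = q.rng then
    ⟨p.rng, q.src, Pth.comp (cast (congrArg (S.Pth p.rng) h) p.pth) q.pth⟩
  else p

/-- `q` is a prefix of `p`, i.e. `p` extends `q`. -/
def IsPrefix (S : SSA) (q p : Path S) : Prop :=
  ∃ r : Path S, q.src = r.rng ∧ p = q.comp r

/-- Two paths are comparable if one is a prefix of the other. -/
def Comparable (S : SSA) (p q : Path S) : Prop := IsPrefix S p q ∨ IsPrefix S q p

/-- The extended left action of groupoid arrows on finite paths,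
given by the recursive recipe `g · v = r g`, `g · (e μ) = (g · e) (g|_e · μ)`. -/
def pactAux (S : SSA) : ∀ {a b : S.V}, S.G → S.Pth a b → Path S
  | _, _, g, .nil _ => Path.vert S (S.gr g)
  | _, _, g, .cons e p => (Path.ofEdge S (S.act g e)).comp (pactAux S (S.res g e) p)

/-- The extended left action `g · μ` on finite paths. -/
def pact (S : SSA) (g : S.G) (p : Path S) : Path S := pactAux S g p.pth

/-- The extended restriction map, given by `g|_v = g` and `g|_{e μ} = (g|_e)|_μ`. -/
def presAux (S : SSA) : ∀ {a b : S.V}, S.G → S.Pth a b → S.G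
  | _, _, g, .nil _ => g
  | _, _, g, .cons e p => presAux S (S.res g e) p

/-- The extended restriction map `g |_μ` on finite paths. -/
def pres (S : SSA) (g : S.G) (p : Path S) : S.G := presAux S g p.pth

/-- `g` strongly fixes the path `p` : `g · p = p` and `g|_p = s p`. -/
def SFix (S : SSA) (g : S.G) (p : Path S) : Prop :=
  S.gs g = p.rng ∧ pact S g p = p ∧ pres S g p = S.one p.src

/-- `p` is a minimal strongly `g`-fixed path. -/
def MinSFix (S : SSA) (g : S.G) (p : Path S) : Prop :=
  SFix S g p ∧ ∀ q : Path S, IsPrefix S q p → q ≠ p → ¬ SFix S g q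

/-- `g` is a unit of the groupoid (an element of `G⁰`). -/
def IsUnitArrow (S : SSA) (g : S.G) : Prop := g = S.one (S.gs g)

/-- `g` fixes every path in `s(g)E^*`. -/
def FixesAll (S : SSA) (g : S.G) : Prop :=
  ∀ p : Path S, p.rng = S.gs g → pact S g p = p

/-- Condition (Fin): every `g` admits at most finitely many minimal strongly
`g`-fixed paths. -/
def CondFin (S : SSA) : Prop := ∀ g : S.G, {p : Path S | MinSFix S g p}.Finite

/-- Condition (Evr): if `g` fixes every path in `s(g)E^*` then `g` strongly fixes
some path in `s(g)E^*`. -/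
def CondEvr (S : SSA) : Prop := ∀ g : S.G, FixesAll S g → ∃ p : Path S, SFix S g p

/-- `p` is a `g`-cycle: a path of positive length with `g · s(p) = r(p)`. -/
def GCycle (S : SSA) (g : S.G) (p : Path S) : Prop :=
  1 ≤ p.length ∧ S.gs g = p.src ∧ S.gr g = p.rng

/-- The vertex `v` receives at least two distinct edges. -/
def HasEntranceVert (S : SSA) (v : S.V) : Prop :=
  ∃ e f : S.E, e ≠ f ∧ S.er e = v ∧ S.er f = v

/-- Base vertices of a finite path. -/
def Path.baseVerts (p : Path S) : Set S.V :=
  insert p.rng {v : S.V | ∃ e ∈ p.toList, S.es e = v}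

/-- A finite path has an entrance. -/
def Path.hasEntrance (p : Path S) : Prop := ∃ v ∈ p.baseVerts, HasEntranceVert S v

/-- Condition (Cyc): every `G`-cycle has an entrance. -/
def CondCyc (S : SSA) : Prop := ∀ (g : S.G) (p : Path S), GCycle S g p → p.hasEntrance

/-- `g` has slack. -/
def HasSlack (S : SSA) (g : S.G) : Prop :=
  ∃ F : Finset (Path S), (∀ p ∈ F, SFix S g p) ∧
    ∀ q : Path S, q.rng = S.gs g → ∃ p ∈ F, Comparable S p q

/-- Condition (Sla): if `g` fixes every path in `s(g)E^*` then `g` has slack. -/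
def CondSla (S : SSA) : Prop := ∀ g : S.G, FixesAll S g → HasSlack S g

def InfPath.rng (ξ : InfPath S) : S.V := S.er (ξ.seq 0)

/-- Base vertices of an infinite path. -/
def InfPath.baseVerts (ξ : InfPath S) : Set S.V := {v : S.V | ∃ n, S.er (ξ.seq n) = v}

/-- An infinite path has an entrance. -/
def InfPath.hasEntrance (ξ : InfPath S) : Prop := ∃ v ∈ ξ.baseVerts, HasEntranceVert S v

/-- The finite path `p` is a prefix of the infinite path `ξ`. -/
def PrefixOfInf (S : SSA) (p : Path S) (ξ : InfPath S) : Prop :=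
  p.rng = ξ.rng ∧ ∀ i : ℕ, i < p.length → p.toList[i]? = some (ξ.seq i)

/-- Finite or infinite paths. -/
abbrev GenPath (S : SSA) : Type := Path S ⊕ InfPath S

/-- The finite path `p` is a prefix of the finite or infinite path `ξ`. -/
def GPrefix (S : SSA) (p : Path S) : GenPath S → Prop
  | .inl q => IsPrefix S p q
  | .inr ξ => PrefixOfInf S p ξ

/-- The set `vE¹` of edges received by the vertex `v`. -/
def recvSet (S : SSA) (v : S.V) : Set S.E := {e : S.E | S.er e = v}

/-- A vertex is singular if it is a source or an infinite receiver. -/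
def Singular (S : SSA) (v : S.V) : Prop := recvSet S v = ∅ ∨ (recvSet S v).Infinite

/-- A vertex is regular if it is not singular. -/
def Regular (S : SSA) (v : S.V) : Prop := ¬ Singular S v

/-- The preorder `v ≪ w`: there is `v'` with `vE^*v' ≠ ∅` and `v'Gw ≠ ∅`. -/
def ll (S : SSA) (v w : S.V) : Prop :=
  ∃ (p : Path S) (g : S.G), p.rng = v ∧ S.gr g = p.src ∧ S.gs g = w

/-- Cofinality of the self-similar action: for every boundary path (a finite path
with singular source, or an infinite path) and every vertex `v`, some base vertex
`w` of the path satisfies `v ≪ w`. -/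
def Cofinal (S : SSA) : Prop :=
  (∀ p : Path S, Singular S p.src → ∀ v : S.V, ∃ w ∈ p.baseVerts, ll S v w) ∧
  (∀ ξ : InfPath S, ∀ v : S.V, ∃ w ∈ ξ.baseVerts, ll S v w)

def Hereditary (S : SSA) (W : Set S.V) : Prop :=
  ∀ v ∈ W, ∀ p : Path S, p.rng = v → p.src ∈ W

def Saturated (S : SSA) (W : Set S.V) : Prop :=
  ∀ w : S.V, Regular S w → (∀ e : S.E, S.er e = w → S.es e ∈ W) → w ∈ W

def GInvariant (S : SSA) (W : Set S.V) : Prop := ∀ g : S.G, S.gs g ∈ W → S.gr g ∈ W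

/-- `(G,E)`-invariant subsets of `E⁰`: `G`-invariant, hereditary and saturated. -/
def SSAInvariant (S : SSA) (W : Set S.V) : Prop :=
  GInvariant S W ∧ Hereditary S W ∧ Saturated S W

/-- Condition (Con): every vertex is reachable from a `G`-cycle with an entrance. -/
def CondCon (S : SSA) : Prop :=
  ∀ v : S.V, ∃ p : Path S, p.rng = v ∧
    ∃ (g : S.G) (c : Path S), GCycle S g c ∧ c.hasEntrance ∧ p.src ∈ c.baseVerts

/-- The underlying set (with zero `none`) of the inverse semigroup `S(G,E)`. -/
abbrev SGE (S : SSA) : Type := Option (Path S × S.G × Path S)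

/-- Well-formedness of a triple `(α, g, β)` : `r g = s α` and `s g = s β`. -/
def SGE.wf (S : SSA) : SGE S → Prop
  | none => True
  | some (α, g, β) => S.gr g = α.src ∧ S.gs g = β.src

/-- The idempotent `f_α = (α, s α, α)`. -/
def fIdem (S : SSA) (α : Path S) : SGE S := some (α, S.one α.src, α)

/-- The involution `(α,g,β)* = (β,g⁻¹,α)` on `S(G,E)`. -/
def sgeStar (S : SSA) : SGE S → SGE S
  | none => none
  | some (α, g, β) => some (β, S.inv g, α)

/-- The multiplication of the inverse semigroup `S(G,E)`. -/
def sgeMul (S : SSA) : SGE S → SGE S → SGE S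
  | none, _ => none
  | some _, none => none
  | some (α, g, β), some (γ, h, δ) =>
    if SGE.wf S (some (α, g, β)) ∧ SGE.wf S (some (γ, h, δ)) then
      if h1 : ∃ β' : Path S, β.src = Path.rng β' ∧ γ = β.comp β' then
        some (α.comp (pact S g h1.choose), S.mul (pres S g h1.choose) h, δ)
      else if h2 : ∃ γ' : Path S, γ.src = Path.rng γ' ∧ β = γ.comp γ' then
        some (α, S.mul g (S.inv (pres S (S.inv h) h2.choose)),
          δ.comp (pact S (S.inv h) h2.choose))
      else none
    else none

/-- Membership in the subsemigroup `S₀(G,E)` (with zero): triples with `|α| = |β|`. -/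
def domS0 (S : SSA) (x : SGE S) : Prop :=
  SGE.wf S x ∧ (x = none ∨ ∃ (α : Path S) (g : S.G) (β : Path S),
    x = some (α, g, β) ∧ α.length = β.length)

/-- Membership in the subsemigroup `S₀₀(G,E)` (with zero): triples `(g·β, g|_β, β)`. -/
def domS00 (S : SSA) (x : SGE S) : Prop :=
  SGE.wf S x ∧ (x = none ∨ ∃ (g : S.G) (β : Path S),
    S.gs g = β.rng ∧ x = some (pact S g β, pres S g β, β))

/-- `S(G,E)` as raw inverse-semigroup data. -/
def sgeSem (S : SSA) : RawSem (SGE S) := ⟨sgeMul S, sgeStar S, none, SGE.wf S⟩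

/-- `S₀(G,E)` as raw inverse-semigroup data. -/
def sgeSem0 (S : SSA) : RawSem (SGE S) := ⟨sgeMul S, sgeStar S, none, domS0 S⟩

/-- `S₀₀(G,E)` as raw inverse-semigroup data. -/
def sgeSem00 (S : SSA) : RawSem (SGE S) := ⟨sgeMul S, sgeStar S, none, domS00 S⟩

/-- The inductive extension of `σ_⋈` to finite paths:
`σ_⋈(h, s h) = 1`, `σ_⋈(h, e μ) = σ_⋈(h, e) σ_⋈(h|_e, μ)`. -/
def twAux (S : SSA) (σB : S.G → S.E → ℂ) : ∀ {a b : S.V}, S.G → S.Pth a b → ℂ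
  | _, _, _, .nil _ => 1
  | _, _, g, .cons e p => σB g e * twAux S σB (S.res g e) p

/-- The extension `σ_⋈ : G * E^* → 𝕋` of a twist to finite paths. -/
def twP (S : SSA) (σB : S.G → S.E → ℂ) (g : S.G) (p : Path S) : ℂ := twAux S σB g p.pth

/-- The `2`-cocycle `ω_σ` on `S(G,E)` induced by a twist `σ` of `(G,E)`. -/
def omg (S : SSA) (T : Twist S) : SGE S → SGE S → ℂ := fun x y =>
  match x, y with
  | some (_, g, β), some (γ, h, _) =>
    if h1 : ∃ β' : Path S, β.src = Path.rng β' ∧ γ = β.comp β' then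
      twP S T.σB g h1.choose * T.σG (pres S g h1.choose) h
    else if h2 : ∃ γ' : Path S, γ.src = Path.rng γ' ∧ β = γ.comp γ' then
      T.σG g (S.inv (pres S (S.inv h) h2.choose)) * twP S T.σB h (pact S (S.inv h) h2.choose)
    else 1
  | _, _ => 1

end SSA

namespace SSA

variable {S : SSA}

lemma Pth.length_toList {a b : S.V} (p : S.Pth a b) : p.toList.length = p.length := by
  induction p with
  | nil v => rfl
  | cons e p ih => simp [Pth.toList, Pth.length, ih]

lemma Pth.toList_comp {a b c : S.V} (p : S.Pth a b) (q : S.Pth b c) :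
    (p.comp q).toList = p.toList ++ q.toList := by
  induction p with
  | nil v => rfl
  | cons e p ih => simp [Pth.toList, Pth.comp, ih]

lemma comp_rng (p q : Path S) : (p.comp q).rng = p.rng := by
  unfold Path.comp
  split <;> rfl

lemma comp_src {p q : Path S} (h : p.src = q.rng) : (p.comp q).src = q.src := by
  unfold Path.comp
  rw [dif_pos h]

lemma comp_toList {p q : Path S} (h : p.src = q.rng) :
    (p.comp q).toList = p.toList ++ q.toList := by
  obtain ⟨a, b, p⟩ := p
  obtain ⟨b', c, q⟩ := q
  dsimp at h
  subst h
  unfold Path.comp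
  rw [dif_pos rfl]
  exact Pth.toList_comp p q

lemma path_ext_aux {a b : S.V} (p : S.Pth a b) : ∀ {a' b' : S.V} (q : S.Pth a' b'),
    a = a' → p.toList = q.toList → (⟨a, b, p⟩ : Path S) = ⟨a', b', q⟩ := by
  induction p with
  | nil v =>
    intro a' b' q ha h
    cases q with
    | nil => subst ha; rfl
    | cons e q => simp [Pth.toList] at h
  | @cons e b p ih =>
    intro a' b' q ha h
    cases q with
    | nil => simp [Pth.toList] at h
    | @cons e' _ q =>
      simp only [Pth.toList, List.cons.injEq] at h
      obtain ⟨h1, h2⟩ := h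
      subst h1
      have h3 := ih q rfl h2
      simp only [Path.mk.injEq, true_and] at h3
      obtain ⟨h4, h5⟩ := h3
      subst h4
      cases h5
      rfl

lemma path_ext {p q : Path S} (h : p.rng = q.rng) (h' : p.toList = q.toList) : p = q := by
  obtain ⟨a, b, p⟩ := p
  obtain ⟨a', b', q⟩ := q
  dsimp at h
  subst h
  exact path_ext_aux p q rfl h'

lemma exists_suffix {a b : S.V} (q : S.Pth a b) : ∀ {a' c : S.V} (p : S.Pth a' c),
    a = a' → q.toList <+: p.toList → ∃ r : Path S, r.rng = b ∧ p.toList = q.toList ++ r.toList := by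
  induction q with
  | nil v => intro a' c p ha _; exact ⟨⟨a', c, p⟩, ha.symm, rfl⟩
  | @cons e b q ih =>
    intro a' c p ha h
    cases p with
    | nil => simp [Pth.toList] at h
    | @cons e' _ p =>
      simp only [Pth.toList, List.cons_prefix_cons] at h
      obtain ⟨h1, h2⟩ := h
      subst h1
      obtain ⟨r, hr, h3⟩ := ih p rfl h2
      exact ⟨r, hr, by simp [Pth.toList, h3]⟩

lemma isPrefix_iff {q p : Path S} :
    IsPrefix S q p ↔ q.rng = p.rng ∧ q.toList <+: p.toList := by
  constructor
  · rintro ⟨r, hr, rfl⟩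
    rw [comp_rng, comp_toList hr]
    exact ⟨rfl, List.prefix_append _ _⟩
  · rintro ⟨h, h'⟩
    obtain ⟨a, b, q⟩ := q
    obtain ⟨a', b', p⟩ := p
    dsimp at h
    subst h
    obtain ⟨r, hr, h3⟩ := exists_suffix q p rfl h'
    refine ⟨r, hr.symm, path_ext ?_ ?_⟩
    · rw [comp_rng]
    · rw [comp_toList hr.symm]; exact h3

lemma pactAux_spec {a b : S.V} (p : S.Pth a b) : ∀ g : S.G, S.gs g = a →
    (pactAux S g p).rng = S.gr g ∧ (pactAux S g p).toList.length = p.toList.length ∧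
    S.gr (presAux S g p) = (pactAux S g p).src ∧ S.gs (presAux S g p) = b := by
  induction p with
  | nil v =>
    intro g hg
    exact ⟨rfl, rfl, rfl, hg⟩
  | @cons e b p ih =>
    intro g hg
    obtain ⟨h1, h2, h3, h4⟩ := ih (S.res g e) (S.gs_res g e hg)
    have hc : (Path.ofEdge S (S.act g e)).src = (pactAux S (S.res g e) p).rng := by
      rw [h1, S.gr_res g e hg]; rfl
    simp only [pactAux, presAux]
    refine ⟨?_, ?_, ?_, h4⟩
    · rw [comp_rng]; exact S.er_act g e hg
    · rw [comp_toList hc]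
      simp [h2, Path.ofEdge, Path.toList, Pth.toList] at h2 ⊢
    · rw [comp_src hc, h3]

lemma pact_spec {g : S.G} {p : Path S} (h : S.gs g = p.rng) :
    (pact S g p).rng = S.gr g ∧ (pact S g p).toList.length = p.toList.length ∧
    S.gr (pres S g p) = (pact S g p).src ∧ S.gs (pres S g p) = p.src :=
  pactAux_spec p.pth g h

lemma one_mul_one (v : S.V) : S.mul (S.one v) (S.one v) = S.one v := by
  have := S.mul_one' (S.one v)
  rwa [S.gs_one] at this

lemma inv_one (v : S.V) : S.inv (S.one v) = S.one v := by
  have h1 := S.mul_one' (S.inv (S.one v))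
  have h2 := S.inv_mul' (S.one v)
  rw [S.gs_inv, S.gr_one] at h1
  rw [S.gs_one] at h2
  exact h1.symm.trans h2

lemma eq_one_of_idem {g : S.G} (hg : S.gs g = S.gr g) (h : S.mul g g = g) :
    g = S.one (S.gs g) := by
  have h1 := S.mul_assoc' (S.inv g) g g (S.gs_inv g) hg
  rw [h, S.inv_mul'] at h1
  rw [hg, S.one_mul', ← hg] at h1
  exact h1

lemma res_one (e : S.E) : S.res (S.one (S.er e)) e = S.one (S.es e) := by
  have hs := S.gs_res (S.one (S.er e)) e (S.gs_one _)
  have hr := S.gr_res (S.one (S.er e)) e (S.gs_one _)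
  rw [S.act_one] at hr
  have h := S.res_mul (S.one (S.er e)) (S.one (S.er e)) e (by rw [S.gs_one, S.gr_one])
    (S.gs_one _)
  rw [one_mul_one, S.act_one] at h
  have := eq_one_of_idem (hs.trans hr.symm) h.symm
  rwa [hs] at this

lemma paux_one {a b : S.V} (p : S.Pth a b) :
    pactAux S (S.one a) p = ⟨a, b, p⟩ ∧ presAux S (S.one a) p = S.one b := by
  induction p with
  | nil v => exact ⟨congrArg (Path.vert S) (S.gr_one v), rfl⟩
  | @cons e b p ih =>
    simp only [pactAux, presAux, res_one, S.act_one, ih.1, ih.2, and_true]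
    have hc : (Path.ofEdge S e).src = (⟨S.es e, b, p⟩ : Path S).rng := rfl
    apply path_ext
    · rw [comp_rng]; rfl
    · rw [comp_toList hc]; rfl

lemma pact_one {v : S.V} {p : Path S} (h : v = p.rng) : pact S (S.one v) p = p := by
  subst h; exact (paux_one p.pth).1

lemma pres_one {v : S.V} {p : Path S} (h : v = p.rng) : pres S (S.one v) p = S.one p.src := by
  subst h; exact (paux_one p.pth).2

lemma wf_fIdem (α : Path S) : SGE.wf S (fIdem S α) := ⟨S.gr_one _, S.gs_one _⟩

lemma isPrefix_refl (p : Path S) : IsPrefix S p p := isPrefix_iff.2 ⟨rfl, List.prefix_rfl⟩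

lemma fIdem_mul_self (α : Path S) : sgeMul S (fIdem S α) (fIdem S α) = fIdem S α := by
  have h : ∃ β' : Path S, α.src = Path.rng β' ∧ α = α.comp β' := isPrefix_refl α
  have hw : SGE.wf S (some (α, S.one α.src, α)) := wf_fIdem α
  simp only [fIdem, sgeMul]
  rw [if_pos ⟨hw, hw⟩, dif_pos h]
  obtain ⟨h1, h2⟩ := h.choose_spec
  have h3 : h.choose.src = α.src := by rw [← comp_src h1, ← h2]
  rw [pact_one h1, pres_one h1, h3, one_mul_one, ← h2]

lemma fIdem_star (α : Path S) : sgeStar S (fIdem S α) = fIdem S α := by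
  simp [fIdem, sgeStar, inv_one]

lemma fIdem_mul_ne (α β : Path S) :
    sgeMul S (fIdem S α) (fIdem S β) ≠ none ↔ Comparable S α β := by
  have hw : SGE.wf S (some (α, S.one α.src, α)) := wf_fIdem α
  have hw' : SGE.wf S (some (β, S.one β.src, β)) := wf_fIdem β
  simp only [fIdem, sgeMul]
  rw [if_pos ⟨hw, hw'⟩]
  unfold Comparable IsPrefix
  split_ifs with h1 h2
  · simp [h1]
  · simp [h2]
  · simp only [ne_eq, not_true_eq_false, false_iff]
    exact not_or.2 ⟨h1, h2⟩

lemma append_length_eq {l : List S.E} {r : List S.E} (h : l = l ++ r) : r = [] := by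
  simpa using h

lemma idem_eq {x : SGE S} (hw : SGE.wf S x) (h : sgeMul S x x = x) (h0 : x ≠ none) :
    ∃ α, x = fIdem S α := by
  obtain _ | ⟨α, g, β⟩ := x
  · exact absurd rfl h0
  simp only [sgeMul] at h
  rw [if_pos ⟨hw, hw⟩] at h
  obtain ⟨w1, w2⟩ := hw
  have key : α = β → ∃ γ, some (α, g, β) = fIdem S γ := by
    rintro rfl
    refine ⟨α, ?_⟩
    have hp : ∃ β' : Path S, α.src = Path.rng β' ∧ α = α.comp β' := isPrefix_refl α
    rw [dif_pos hp] at h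
    obtain ⟨h1, h2⟩ := hp.choose_spec
    generalize hp.choose = q at h1 h2 h
    have hq : q.toList = [] := by
      apply append_length_eq (l := α.toList)
      rw [← comp_toList h1, ← h2]
    have hq' : q = Path.vert S α.src := path_ext h1.symm hq
    subst hq'
    simp only [Option.some.injEq, Prod.mk.injEq] at h
    have h3 : S.mul g g = g := h.2.1
    have := eq_one_of_idem (w2.trans w1.symm) h3
    rw [w2] at this
    simp [fIdem, ← this]
  split_ifs at h with h1 h2
  · apply key
    obtain ⟨a1, a2⟩ := h1.choose_spec
    generalize h1.choose = q at a1 a2 h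
    simp only [Option.some.injEq, Prod.mk.injEq] at h
    have hs := pact_spec (g := g) (p := q) (w2.trans a1)
    have hc : α.src = (pact S g q).rng := by rw [hs.1, w1]
    have e1 : (pact S g q).toList = [] := by
      apply append_length_eq (l := α.toList)
      rw [← comp_toList hc, h.1]
    have e2 : q.toList = [] := by
      rw [← List.length_eq_zero_iff, ← hs.2.1, e1]; rfl
    rw [a2]
    apply path_ext
    · rw [comp_rng]
    · rw [comp_toList a1, e2, List.append_nil]
  · apply key
    obtain ⟨a1, a2⟩ := h2.choose_spec
    generalize h2.choose = q at a1 a2 h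
    simp only [Option.some.injEq, Prod.mk.injEq] at h
    have hs := pact_spec (g := S.inv g) (p := q) (by rw [S.gs_inv, w1, a1])
    have hc : β.src = (pact S (S.inv g) q).rng := by rw [hs.1, S.gr_inv, w2]
    have e1 : (pact S (S.inv g) q).toList = [] := by
      apply append_length_eq (l := β.toList)
      rw [← comp_toList hc, h.2.2]
    have e2 : q.toList = [] := by
      rw [← List.length_eq_zero_iff, ← hs.2.1, e1]; rfl
    rw [a2]
    apply path_ext
    · rw [comp_rng]
    · rw [comp_toList a1, e2, List.append_nil]

lemma comp_cancel {p q r : Path S} (h : p.src = q.rng) (h' : p.src = r.rng)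
    (e : p.comp q = p.comp r) : q = r := by
  apply path_ext (h.symm.trans h')
  have := congrArg Path.toList e
  rw [comp_toList h, comp_toList h'] at this
  exact List.append_cancel_left this

lemma le_iff {β γ : Path S} {g : S.G} (hw : SGE.wf S (some (β, g, γ))) (α : Path S) :
    fIdem S α = sgeMul S (some (β, g, γ)) (sgeMul S (sgeStar S (fIdem S α)) (fIdem S α)) ↔
    β = γ ∧ ∃ α', γ.src = Path.rng α' ∧ α = γ.comp α' ∧ SFix S g α' := by
  rw [fIdem_star, fIdem_mul_self]
  have hwa : SGE.wf S (some (α, S.one α.src, α)) := wf_fIdem α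
  simp only [fIdem, sgeMul]
  rw [if_pos ⟨hw, hwa⟩]
  obtain ⟨w1, w2⟩ := hw
  constructor
  · intro h
    split_ifs at h with h1 h2
    · obtain ⟨a1, a2⟩ := h1.choose_spec
      generalize h1.choose = q at a1 a2 h
      simp only [Option.some.injEq, Prod.mk.injEq, and_true] at h
      have hs := pact_spec (g := g) (p := q) (w2.trans a1)
      have hc : β.src = (pact S g q).rng := by rw [hs.1, w1]
      have hl := congrArg Path.toList (a2.symm.trans h.1)
      rw [comp_toList a1, comp_toList hc] at hl
      obtain ⟨e1, e2⟩ := List.append_inj' hl hs.2.1.symm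
      have hbg : β = γ := by
        refine path_ext ?_ e1.symm
        rw [← comp_rng β (pact S g q), ← h.1, a2, comp_rng]
      refine ⟨hbg, q, a1, a2, w2.trans a1, path_ext ?_ e2.symm, ?_⟩
      · rw [← hc, hbg, a1]
      · have hq : α.src = q.src := by rw [a2, comp_src a1]
        have h3 := h.2
        rw [hq, ← hs.2.2.2, S.mul_one', hs.2.2.2] at h3
        exact h3.symm
    · exfalso
      obtain ⟨a1, a2⟩ := h2.choose_spec
      generalize h2.choose = q at a1 a2 h
      simp only [Option.some.injEq, Prod.mk.injEq] at h
      rw [inv_one, pact_one a1, ← a2] at h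
      apply h1
      rw [h.2.2]
      exact isPrefix_refl γ
  · rintro ⟨rfl, q, a1, a2, s1, s2, s3⟩
    have h1 : ∃ β' : Path S, β.src = Path.rng β' ∧ α = β.comp β' := ⟨q, a1, a2⟩
    rw [dif_pos h1]
    have hq : h1.choose = q :=
      comp_cancel h1.choose_spec.1 a1 (h1.choose_spec.2.symm.trans a2)
    rw [hq, s2, s3, ← a2, a2, comp_src a1, one_mul_one]

/-- The raw semigroup data with varying domain. -/
def semOf (S : SSA) (D : SGE S → Prop) : RawSem (SGE S) := ⟨sgeMul S, sgeStar S, none, D⟩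

lemma nzIdem_iff {D : SGE S → Prop} (hD : ∀ x, D x → SGE.wf S x) (hI : ∀ α, D (fIdem S α))
    (x : SGE S) : (semOf S D).NzIdem x ↔ ∃ α, x = fIdem S α := by
  constructor
  · rintro ⟨h1, h2, h3⟩
    exact idem_eq (hD x h1) h2 h3
  · rintro ⟨α, rfl⟩
    exact ⟨hI α, fIdem_mul_self α, by simp [fIdem, semOf]⟩

lemma sfix_one {v : S.V} {p : Path S} (h : v = p.rng) : SFix S (S.one v) p :=
  ⟨by rw [S.gs_one, h], pact_one h, pres_one h⟩

lemma le_fIdem {D : SGE S → Prop} (α β : Path S) :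
    (semOf S D).le (fIdem S α) (fIdem S β) ↔ IsPrefix S β α := by
  refine (le_iff (wf_fIdem β) α).trans ?_
  constructor
  · rintro ⟨_, q, h1, h2, _⟩
    exact ⟨q, h1, h2⟩
  · rintro ⟨q, h1, h2⟩
    exact ⟨rfl, q, h1, h2, sfix_one h1⟩

lemma isPrefix_trans {p q r : Path S} (h : IsPrefix S p q) (h' : IsPrefix S q r) :
    IsPrefix S p r := by
  rw [isPrefix_iff] at *
  exact ⟨h.1.trans h'.1, h.2.trans h'.2⟩

lemma prefix_comparable {p q r : Path S} (h : IsPrefix S p r) (h' : IsPrefix S q r) :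
    Comparable S p q := by
  unfold Comparable
  rw [isPrefix_iff] at *
  rw [isPrefix_iff]
  rcases List.prefix_or_prefix_of_prefix h.2 h'.2 with h1 | h1
  · exact Or.inl ⟨h.1.trans h'.1.symm, h1⟩
  · exact Or.inr ⟨h'.1.trans h.1.symm, h1⟩

lemma exists_min {g : S.G} : ∀ (n : ℕ) (p : Path S), p.toList.length = n → SFix S g p →
    ∃ q, IsPrefix S q p ∧ MinSFix S g q := by
  intro n
  induction n using Nat.strong_induction_on with
  | _ n ih =>
    intro p hn hp
    by_cases hm : MinSFix S g p
    · exact ⟨p, isPrefix_refl p, hm⟩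
    · unfold MinSFix at hm
      push Not at hm
      obtain ⟨q, h1, h2, h3⟩ := hm hp
      have hlt : q.toList.length < n := by
        obtain ⟨a, b⟩ := isPrefix_iff.1 h1
        rw [← hn]
        refine lt_of_le_of_ne b.length_le fun hl => h2 (path_ext a (b.eq_of_length hl))
      obtain ⟨r, hr, hr'⟩ := ih _ hlt q rfl h3
      exact ⟨r, isPrefix_trans hr h1, hr'⟩

lemma isPrefix_comp_left {p q r : Path S} (h : p.src = r.rng) (h' : IsPrefix S q r) :
    IsPrefix S (p.comp q) (p.comp r) := by
  rw [isPrefix_iff] at *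
  rw [comp_rng, comp_rng, comp_toList h, comp_toList (h.trans h'.1.symm)]
  exact ⟨rfl, (List.prefix_append_right_inj _).2 h'.2⟩

lemma closed_of_fin (hF : CondFin S) {D : SGE S → Prop} (hD : ∀ x, D x → SGE.wf S x)
    (hI : ∀ α, D (fIdem S α)) : (semOf S D).Closed := by
  intro t ht
  obtain _ | ⟨β, g, γ⟩ := t
  · refine ⟨∅, by simp, ?_⟩
    rintro e ⟨he, hle⟩
    exact absurd hle he.2.2
  have hw := hD _ ht
  have hfix : ∀ α, (semOf S D).le (fIdem S α) (some (β, g, γ)) ↔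
      β = γ ∧ ∃ α', γ.src = Path.rng α' ∧ α = γ.comp α' ∧ SFix S g α' := le_iff hw
  by_cases hbg : β = γ
  swap
  · refine ⟨∅, by simp, ?_⟩
    rintro e ⟨he, hle⟩
    obtain ⟨α, rfl⟩ := (nzIdem_iff hD hI e).1 he
    exact absurd ((hfix α).1 hle).1 hbg
  subst hbg
  have hsrc : ∀ p, SFix S g p → β.src = p.rng := fun p hp => hw.2.symm.trans hp.1
  refine ⟨((hF g).image fun p => fIdem S (β.comp p)).toFinset, ?_, ?_⟩
  · intro x hx
    simp only [Set.Finite.coe_toFinset] at hx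
    obtain ⟨p, hp, rfl⟩ := hx
    exact ⟨(nzIdem_iff hD hI _).2 ⟨_, rfl⟩,
      (hfix _).2 ⟨rfl, p, hsrc p hp.1, rfl, hp.1⟩⟩
  · rintro e ⟨he, hle⟩ z hz hze
    obtain ⟨α, rfl⟩ := (nzIdem_iff hD hI e).1 he
    obtain ⟨δ, rfl⟩ := (nzIdem_iff hD hI z).1 hz
    rw [le_fIdem] at hze
    obtain ⟨_, q, hq, rfl, hs⟩ := (hfix α).1 hle
    obtain ⟨r, hr, hm⟩ := exists_min _ q rfl hs
    refine ⟨fIdem S (β.comp r), ?_, ?_⟩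
    · simp only [Set.Finite.coe_toFinset]
      exact ⟨r, hm, rfl⟩
    · exact (fIdem_mul_ne _ _).2 (Or.inr (isPrefix_trans (isPrefix_comp_left hq hr) hze))

lemma vert_comp (v : S.V) {p : Path S} (h : v = p.rng) : (Path.vert S v).comp p = p := by
  apply path_ext
  · rw [comp_rng]; exact h
  · rw [comp_toList (p := Path.vert S v) h]; rfl

lemma fin_of_closed {D : SGE S → Prop} (hD : ∀ x, D x → SGE.wf S x)
    (hI : ∀ α, D (fIdem S α))
    (hV : ∀ g, D (some (Path.vert S (S.gr g), g, Path.vert S (S.gs g))))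
    (hC : (semOf S D).Closed) : CondFin S := by
  intro g
  obtain ⟨F, hF, hcov⟩ := hC _ (hV g)
  have hfix : ∀ α, (semOf S D).le (fIdem S α)
      (some (Path.vert S (S.gr g), g, Path.vert S (S.gs g))) ↔
      Path.vert S (S.gr g) = Path.vert S (S.gs g) ∧ ∃ α', S.gs g = Path.rng α' ∧
        α = (Path.vert S (S.gs g)).comp α' ∧ SFix S g α' := le_iff (hD _ (hV g))
  have hmemF : ∀ x ∈ F, ∃ α, x = fIdem S α ∧ SFix S g α := by
    intro x hx
    obtain ⟨h1, h2⟩ := hF hx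
    obtain ⟨α, rfl⟩ := (nzIdem_iff hD hI x).1 h1
    obtain ⟨_, q, hq, rfl, hs⟩ := (hfix α).1 h2
    rw [vert_comp _ hq]
    exact ⟨q, rfl, hs⟩
  have hpre : ∀ p, MinSFix S g p → ∃ x ∈ F, ∃ α, x = fIdem S α ∧ IsPrefix S p α := by
    intro p hp
    have hgr : S.gr g = S.gs g := by
      rw [← (pact_spec hp.1.1).1, hp.1.2.1, hp.1.1]
    have hmem : fIdem S p ∈ (semOf S D).TrivFix
        (some (Path.vert S (S.gr g), g, Path.vert S (S.gs g))) := by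
      refine ⟨(nzIdem_iff hD hI _).2 ⟨_, rfl⟩, (hfix p).2 ⟨by rw [hgr], p, hp.1.1, ?_, hp.1⟩⟩
      rw [vert_comp _ hp.1.1]
    obtain ⟨x, hx, hne⟩ := hcov _ hmem _ hmem.1 ((le_fIdem p p).2 (isPrefix_refl p))
    obtain ⟨α, rfl, hs⟩ := hmemF x hx
    refine ⟨_, hx, α, rfl, ?_⟩
    rcases (fIdem_mul_ne p α).1 hne with h | h
    · exact h
    · by_cases he : α = p
      · rw [he]; exact isPrefix_refl p
      · exact absurd hs (hp.2 α h he)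
  refine Set.Finite.subset (s := ⋃ x ∈ (F : Set (SGE S)),
    {p | MinSFix S g p ∧ ∃ α, x = fIdem S α ∧ IsPrefix S p α}) ?_ ?_
  · refine Set.Finite.biUnion F.finite_toSet fun x _ => Set.Subsingleton.finite ?_
    rintro p ⟨hp, α, hα, hpa⟩ q ⟨hq, β, hβ, hqb⟩
    have hab : α = β := by
      have := hα.symm.trans hβ
      simp only [fIdem, Option.some.injEq, Prod.mk.injEq] at this
      exact this.1
    subst hab
    by_contra hne
    rcases prefix_comparable hpa hqb with h | h
    · exact hq.2 p h hne hp.1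
    · exact hp.2 q h (Ne.symm hne) hq.1
  · intro p hp
    obtain ⟨x, hx, h⟩ := hpre p hp
    simp only [Set.mem_iUnion]
    exact ⟨x, hx, hp, h⟩

end SSA

/-- Condition (Fin) is equivalent to closedness of each of the
inverse semigroups `S(G,E)`, `S₀(G,E)` and `S₀₀(G,E)`. -/
theorem statement4 (S : SSA) :
    List.TFAE [SSA.CondFin S, (SSA.sgeSem S).Closed, (SSA.sgeSem0 S).Closed,
      (SSA.sgeSem00 S).Closed] := by
  have hI1 : ∀ α, SSA.SGE.wf S (SSA.fIdem S α) := SSA.wf_fIdem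
  have hI2 : ∀ α, SSA.domS0 S (SSA.fIdem S α) :=
    fun α => ⟨SSA.wf_fIdem α, Or.inr ⟨α, _, α, rfl, rfl⟩⟩
  have hI3 : ∀ α, SSA.domS00 S (SSA.fIdem S α) := fun α =>
    ⟨SSA.wf_fIdem α, Or.inr ⟨S.one α.rng, α, S.gs_one _, by
      rw [SSA.pact_one rfl, SSA.pres_one rfl]; rfl⟩⟩
  tfae_have 1 → 2 := fun h => SSA.closed_of_fin h (fun _ hx => hx) hI1
  tfae_have 1 → 3 := fun h => SSA.closed_of_fin h (fun _ hx => hx.1) hI2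
  tfae_have 1 → 4 := fun h => SSA.closed_of_fin h (fun _ hx => hx.1) hI3
  tfae_have 2 → 1 := fun h => SSA.fin_of_closed (fun _ hx => hx) hI1
    (fun g => ⟨rfl, rfl⟩) h
  tfae_have 3 → 1 := fun h => SSA.fin_of_closed (fun _ hx => hx.1) hI2
    (fun g => ⟨⟨rfl, rfl⟩, Or.inr ⟨_, _, _, rfl, rfl⟩⟩) h
  tfae_have 4 → 1 := fun h => SSA.fin_of_closed (fun _ hx => hx.1) hI3
    (fun g => ⟨⟨rfl, rfl⟩, Or.inr ⟨g, SSA.Path.vert S (S.gs g), rfl, rfl⟩⟩) h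
  tfae_finish

end
end

section
/- Let (G,E) be a self-similar action and (g,α) with s(g) = r(α), α ∈ E^*. Then the path α has an entrance if and only if the path g·α has an entrance. -/
noncomputable section

attribute [local instance] Classical.propDecidable

namespace SSA

theorem hev_transfer (S : SSA) (g : S.G) (h : HasEntranceVert S (S.gs g)) :
    HasEntranceVert S (S.gr g) := by
  obtain ⟨e, f, hne, he, hf⟩ := h
  refine ⟨S.act g e, S.act g f, ?_, S.er_act g e he.symm, S.er_act g f hf.symm⟩
  intro heq
  apply hne
  have key : ∀ x, S.er x = S.gs g → S.act (S.inv g) (S.act g x) = x := by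
    intro x hx
    rw [← S.act_mul (S.inv g) g x (S.gs_inv g) hx.symm, S.inv_mul', ← hx, S.act_one]
  rw [← key e he, ← key f hf, heq]

theorem hev_iff (S : SSA) (g : S.G) :
    HasEntranceVert S (S.gs g) ↔ HasEntranceVert S (S.gr g) := by
  refine ⟨hev_transfer S g, fun h => ?_⟩
  have := hev_transfer S (S.inv g) (by rw [S.gs_inv]; exact h)
  rwa [S.gr_inv] at this

theorem ent_nil (S : SSA) (v : S.V) :
    (Path.mk v v (Pth.nil v)).hasEntrance ↔ HasEntranceVert S v := by
  simp [Path.hasEntrance, Path.baseVerts, Path.toList, Pth.toList]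

theorem ent_cons (S : SSA) (e : S.E) {b : S.V} (p : S.Pth (S.es e) b) :
    (Path.mk _ _ (Pth.cons e p)).hasEntrance ↔
      HasEntranceVert S (S.er e) ∨ (Path.mk _ _ p).hasEntrance := by
  simp [Path.hasEntrance, Path.baseVerts, Path.toList, Pth.toList]

theorem ent_comp (S : SSA) (e : S.E) (q : Path S) (h : S.es e = q.rng) :
    ((Path.ofEdge S e).comp q).rng = S.er e ∧
    (((Path.ofEdge S e).comp q).hasEntrance ↔
      HasEntranceVert S (S.er e) ∨ q.hasEntrance) := by
  obtain ⟨a, b, r⟩ := q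
  dsimp only at h
  subst h
  have : (Path.ofEdge S e).comp ⟨_, b, r⟩ = ⟨_, b, Pth.cons e r⟩ := by
    exact dif_pos (show (Path.ofEdge S e).src = (Path.mk _ b r).rng from rfl)
  rw [this]
  exact ⟨rfl, ent_cons S e r⟩

theorem ent_pact (S : SSA) {a b : S.V} (p : S.Pth a b) : ∀ g : S.G, S.gs g = a →
    (pactAux S g p).rng = S.gr g ∧
      ((Path.mk a b p).hasEntrance ↔ (pactAux S g p).hasEntrance) := by
  induction p with
  | nil v =>
    intro g h
    refine ⟨rfl, ?_⟩
    rw [ent_nil, ← h]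
    exact (hev_iff S g).trans (ent_nil S _).symm
  | cons e p ih =>
    intro g h
    obtain ⟨h1, h2⟩ := ih (S.res g e) (S.gs_res g e h)
    obtain ⟨h3, h4⟩ := ent_comp S (S.act g e) (pactAux S (S.res g e) p)
      (by rw [h1, S.gr_res g e h])
    refine ⟨?_, ?_⟩
    · rw [pactAux, h3, S.er_act g e h]
    · rw [pactAux, h4, ent_cons, h2, S.er_act g e h, ← h, hev_iff]

end SSA

/-- For composable `(g, α)`, the path `α` has an entrance iff
`g · α` has an entrance. -/
theorem statement7 (S : SSA) (g : S.G) (p : SSA.Path S) (h : S.gs g = p.rng) :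
    p.hasEntrance ↔ (SSA.pact S g p).hasEntrance := by
  exact (SSA.ent_pact S p.pth g h).2

end
end
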